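/- Let n be a positive natural number and let y : (Fin n → ℝ) → ℝ be infinitely differentiable. Then for every point x, the mixed partial derivative ∂ⁿ(exp ∘ y)/∂x₁ ∂x₂ ⋯ ∂xₙ evaluated at x equals exp(y(x)) times the sum, over all partitions π of the set {1, …, n}, of the product over the blocks B of π of the mixed partial derivative ∂^{|B|} y / ∏_{j ∈ B} ∂x_j evaluated at x. -/

import Mathlib

/-- Iterated directional (line) derivative along a list of direction vectors. -/
noncomputable def iterLineDeriv {E : Type*} [NormedAddCommGroup E] [NormedSpace ℝ E] :
    List E → (E → ℝ) → E → ℝ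
  | [], g => g
  | v :: vs, g => fun x => lineDeriv ℝ (iterLineDeriv vs g) x v

theorem ContDiff.lineDeriv_top {E : Type*} [NormedAddCommGroup E] [NormedSpace ℝ E]
    {g : E → ℝ} (hg : ContDiff ℝ (⊤ : ℕ∞) g) (v : E) :
    ContDiff ℝ (⊤ : ℕ∞) fun x => lineDeriv ℝ g x v := by
  have h : (fun x => lineDeriv ℝ g x v) = fun x => fderiv ℝ g x v := by
    ext x
    exact ((hg.differentiable (by simp)) x).lineDeriv_eq_fderiv
  rw [h]
  exact (hg.fderiv_right (m := (⊤ : ℕ∞)) (by simp)).clm_apply contDiff_const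

theorem contDiff_iterLineDeriv {E : Type*} [NormedAddCommGroup E] [NormedSpace ℝ E]
    {g : E → ℝ} (hg : ContDiff ℝ (⊤ : ℕ∞) g) (l : List E) :
    ContDiff ℝ (⊤ : ℕ∞) (iterLineDeriv l g) := by
  induction l with
  | nil => exact hg
  | cons v l ih => exact ih.lineDeriv_top v

theorem ContDiff.lineDeriv_comm {E : Type*} [NormedAddCommGroup E] [NormedSpace ℝ E]
    {g : E → ℝ} (hg : ContDiff ℝ (⊤ : ℕ∞) g) (v w x : E) :
    lineDeriv ℝ (fun z => lineDeriv ℝ g z v) x w =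
      lineDeriv ℝ (fun z => lineDeriv ℝ g z w) x v := by
  have hd : Differentiable ℝ (fderiv ℝ g) :=
    (hg.fderiv_right (m := (⊤ : ℕ∞)) (by simp)).differentiable (by simp)
  have key (u u' : E) : lineDeriv ℝ (fun z => lineDeriv ℝ g z u) x u' =
      fderiv ℝ (fderiv ℝ g) x u' u := by
    rw [((hg.lineDeriv_top u).differentiable (by simp) x).lineDeriv_eq_fderiv]
    have h : (fun z => lineDeriv ℝ g z u) = fun z => fderiv ℝ g z u := by
      ext z
      exact ((hg.differentiable (by simp)) z).lineDeriv_eq_fderiv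
    rw [h, fderiv_clm_apply (hd x) (differentiableAt_const u)]
    simp
  rw [key, key]
  refine (hg.contDiffAt.isSymmSndFDerivAt ?_) w v
  simp only [minSmoothness_of_isRCLikeNormedField]
  exact WithTop.coe_le_coe.2 (le_top (a := (2 : ℕ∞)))

theorem iterLineDeriv_perm {E : Type*} [NormedAddCommGroup E] [NormedSpace ℝ E]
    {g : E → ℝ} (hg : ContDiff ℝ (⊤ : ℕ∞) g) {l l' : List E} (h : l.Perm l') :
    iterLineDeriv l g = iterLineDeriv l' g := by
  induction h with
  | nil => rfl
  | cons v _ ih => simp only [iterLineDeriv, ih]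
  | swap v w l =>
    ext x
    exact (contDiff_iterLineDeriv hg l).lineDeriv_comm v w x
  | trans _ _ ih₁ ih₂ => exact ih₁.trans ih₂

theorem iterLineDeriv_toList_insert {E α : Type*} [NormedAddCommGroup E] [NormedSpace ℝ E]
    [DecidableEq α] {g : E → ℝ} (hg : ContDiff ℝ (⊤ : ℕ∞) g) (v : α → E) {a : α} {s : Finset α}
    (ha : a ∉ s) (x : E) :
    iterLineDeriv ((insert a s).toList.map v) g x =
      lineDeriv ℝ (iterLineDeriv (s.toList.map v) g) x (v a) := by
  rw [iterLineDeriv_perm hg ((Finset.toList_insert ha).map v)]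
  rfl

namespace Finpartition

variable {α : Type*} [DecidableEq α] {s : Finset α} {a : α}

/-- The partition of `insert a s` obtained by adjoining `a` to `B`, where `B` is a block of `P`, or
empty, in which case `{a}` becomes a block. -/
def adjoin (P : Finpartition s) (ha : a ∉ s) (B : Finset α) (hB : B ∈ insert ∅ P.parts) :
    Finpartition (insert a s) :=
  ofExistsUnique (insert (insert a B) (P.parts.erase B))
    (by
      have hBs : B ⊆ s := by
        rcases Finset.mem_insert.1 hB with rfl | h
        exacts [Finset.empty_subset _, P.subset h]
      intro p hp
      rcases Finset.mem_insert.1 hp with rfl | hp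
      · exact Finset.insert_subset_insert a hBs
      · exact (P.subset (Finset.mem_of_mem_erase hp)).trans (Finset.subset_insert a s))
    (by
      intro b hb
      by_cases hbB : b ∈ insert a B
      · refine ⟨insert a B, ⟨Finset.mem_insert_self _ _, hbB⟩, ?_⟩
        rintro t ⟨ht, hbt⟩
        rcases Finset.mem_insert.1 ht with rfl | ht
        · rfl
        obtain ⟨htB, htP⟩ := Finset.mem_erase.1 ht
        rcases Finset.mem_insert.1 hbB with rfl | hbB
        · exact absurd (P.subset htP hbt) ha
        rcases Finset.mem_insert.1 hB with rfl | hB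
        · simp at hbB
        · exact absurd (P.eq_of_mem_parts htP hB hbt hbB) htB
      · rw [Finset.mem_insert, not_or] at hbB
        obtain ⟨t, ⟨ht, hbt⟩, hu⟩ :=
          P.existsUnique_mem ((Finset.mem_insert.1 hb).resolve_left hbB.1)
        refine ⟨t, ⟨Finset.mem_insert_of_mem (Finset.mem_erase.2 ⟨?_, ht⟩), hbt⟩, ?_⟩
        · rintro rfl
          exact hbB.2 hbt
        · rintro u ⟨hu', hbu⟩
          rcases Finset.mem_insert.1 hu' with rfl | hu'
          · simp [hbB] at hbu
          · exact hu u ⟨Finset.mem_of_mem_erase hu', hbu⟩)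
    (by simp [(Finset.insert_ne_empty a B).symm])

theorem parts_adjoin (P : Finpartition s) (ha : a ∉ s) (B : Finset α)
    (hB : B ∈ insert ∅ P.parts) :
    (P.adjoin ha B hB).parts = insert (insert a B) (P.parts.erase B) := rfl

theorem notMem_of_mem_insert_empty_parts (P : Finpartition s) (ha : a ∉ s) {B : Finset α}
    (hB : B ∈ insert ∅ P.parts) : a ∉ B := by
  rcases Finset.mem_insert.1 hB with rfl | hB
  exacts [Finset.notMem_empty a, fun h => ha (P.subset hB h)]

theorem insert_notMem_erase_parts (P : Finpartition s) (ha : a ∉ s) (B : Finset α) :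
    insert a B ∉ P.parts.erase B := fun h =>
  ha (P.subset (Finset.mem_of_mem_erase h) (Finset.mem_insert_self a B))

theorem part_adjoin (P : Finpartition s) (ha : a ∉ s) (B : Finset α)
    (hB : B ∈ insert ∅ P.parts) : (P.adjoin ha B hB).part a = insert a B :=
  part_eq_of_mem _ (Finset.mem_insert_self _ _) (Finset.mem_insert_self _ _)

/-- The partition of `s` obtained by deleting `a` from a partition of `insert a s`. -/
def deletePoint (Q : Finpartition (insert a s)) (ha : a ∉ s) : Finpartition s :=
  ofExistsUnique ((insert ((Q.part a).erase a) (Q.parts.erase (Q.part a))).erase ∅)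
    (by
      intro p hp
      rcases Finset.mem_insert.1 (Finset.mem_of_mem_erase hp) with rfl | hp
      · rw [← Finset.subset_insert_iff]
        exact Q.part_subset a
      · obtain ⟨hpa, hp⟩ := Finset.mem_erase.1 hp
        refine (Finset.subset_insert_iff_of_notMem fun h => hpa ?_).1 (Q.subset hp)
        exact (Q.part_eq_of_mem hp h).symm)
    (by
      intro b hb
      have hba : b ≠ a := fun h => ha (h ▸ hb)
      obtain ⟨t, ⟨ht, hbt⟩, hu⟩ := Q.existsUnique_mem (Finset.mem_insert_of_mem hb)
      by_cases hta : t = Q.part a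
      · subst hta
        have hbe := Finset.mem_erase.2 ⟨hba, hbt⟩
        refine ⟨(Q.part a).erase a, ⟨Finset.mem_erase.2
          ⟨Finset.ne_empty_of_mem hbe, Finset.mem_insert_self _ _⟩, hbe⟩, ?_⟩
        rintro u ⟨hu', hbu⟩
        rcases Finset.mem_insert.1 (Finset.mem_of_mem_erase hu') with rfl | hu'
        · rfl
        · obtain ⟨hua, hu'⟩ := Finset.mem_erase.1 hu'
          exact absurd (hu u ⟨hu', hbu⟩) hua
      · refine ⟨t, ⟨Finset.mem_erase.2 ⟨Finset.ne_empty_of_mem hbt,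
          Finset.mem_insert_of_mem (Finset.mem_erase.2 ⟨hta, ht⟩)⟩, hbt⟩, ?_⟩
        rintro u ⟨hu', hbu⟩
        rcases Finset.mem_insert.1 (Finset.mem_of_mem_erase hu') with rfl | hu'
        · exact absurd (hu (Q.part a) ⟨Q.part_mem.2 (Finset.mem_insert_self a s),
            Finset.mem_of_mem_erase hbu⟩).symm hta
        · exact hu u ⟨Finset.mem_of_mem_erase hu', hbu⟩)
    (by simp)

theorem parts_deletePoint (Q : Finpartition (insert a s)) (ha : a ∉ s) :
    (Q.deletePoint ha).parts =
      (insert ((Q.part a).erase a) (Q.parts.erase (Q.part a))).erase ∅ := rfl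

theorem erase_part_mem (Q : Finpartition (insert a s)) (ha : a ∉ s) :
    (Q.part a).erase a ∈ insert ∅ (Q.deletePoint ha).parts := by
  rw [parts_deletePoint, Finset.mem_insert, Finset.mem_erase]
  exact or_iff_not_imp_left.2 fun h => ⟨h, Finset.mem_insert_self _ _⟩

theorem deletePoint_adjoin (P : Finpartition s) (ha : a ∉ s) (B : Finset α)
    (hB : B ∈ insert ∅ P.parts) : (P.adjoin ha B hB).deletePoint ha = P := by
  ext1
  rw [parts_deletePoint, part_adjoin, parts_adjoin,
    Finset.erase_insert (P.notMem_of_mem_insert_empty_parts ha hB),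
    Finset.erase_insert (P.insert_notMem_erase_parts ha B)]
  have h0 : ∅ ∉ P.parts := P.empty_notMem_parts
  rcases Finset.mem_insert.1 hB with rfl | hB
  · rw [Finset.erase_eq_of_notMem h0, Finset.erase_insert h0]
  · rw [Finset.insert_erase hB, Finset.erase_eq_of_notMem h0]

theorem adjoin_deletePoint (Q : Finpartition (insert a s)) (ha : a ∉ s) :
    (Q.deletePoint ha).adjoin ha ((Q.part a).erase a) (Q.erase_part_mem ha) = Q := by
  have has := Finset.mem_insert_self a s
  have hpart := Q.part_mem.2 has
  have h0 : ∅ ∉ Q.parts.erase (Q.part a) := fun h =>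
    Q.empty_notMem_parts (Finset.mem_of_mem_erase h)
  have h1 : (Q.part a).erase a ∉ Q.parts.erase (Q.part a) := by
    intro h
    obtain ⟨hne, h⟩ := Finset.mem_erase.1 h
    obtain ⟨b, hb⟩ := Q.nonempty_of_mem_parts h
    exact hne (Q.eq_of_mem_parts h hpart hb (Finset.mem_of_mem_erase hb))
  ext1
  rw [parts_adjoin, parts_deletePoint, Finset.erase_right_comm, Finset.erase_insert h1,
    Finset.erase_eq_of_notMem h0, Finset.insert_erase (Q.mem_part_self.2 has),
    Finset.insert_erase hpart]

theorem sum_insert {R : Type*} [CommSemiring R] (ha : a ∉ s) (f : Finset α → R) :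
    ∑ Q : Finpartition (insert a s), ∏ B ∈ Q.parts, f B =
      ∑ P : Finpartition s,
        (f {a} * ∏ B ∈ P.parts, f B +
          ∑ B ∈ P.parts, (∏ C ∈ P.parts.erase B, f C) * f (insert a B)) := by
  have h (P : Finpartition s) : f {a} * ∏ B ∈ P.parts, f B +
      ∑ B ∈ P.parts, (∏ C ∈ P.parts.erase B, f C) * f (insert a B) =
      ∑ B ∈ insert ∅ P.parts, (∏ C ∈ P.parts.erase B, f C) * f (insert a B) := by
    rw [Finset.sum_insert P.empty_notMem_parts, Finset.erase_eq_of_notMem P.empty_notMem_parts,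
      mul_comm]
    rfl
  simp_rw [h]
  rw [Finset.sum_sigma']
  symm
  refine Finset.sum_bij' (fun p hp => p.1.adjoin ha p.2 (Finset.mem_sigma.1 hp).2)
    (fun Q _ => ⟨Q.deletePoint ha, (Q.part a).erase a⟩) (fun _ _ => Finset.mem_univ _)
    (fun Q _ => Finset.mem_sigma.2 ⟨Finset.mem_univ _, Q.erase_part_mem ha⟩) ?_
    (fun Q _ => Q.adjoin_deletePoint ha) ?_
  · rintro ⟨P, B⟩ hp
    have hB := (Finset.mem_sigma.1 hp).2
    simp only [deletePoint_adjoin, part_adjoin,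
      Finset.erase_insert (P.notMem_of_mem_insert_empty_parts ha hB)]
  · rintro ⟨P, B⟩ hp
    rw [parts_adjoin, Finset.prod_insert (P.insert_notMem_erase_parts ha B), mul_comm]

end Finpartition

theorem iterLineDeriv_exp_comp {E α : Type*} [NormedAddCommGroup E] [NormedSpace ℝ E]
    [DecidableEq α] {y : E → ℝ} (hy : ContDiff ℝ (⊤ : ℕ∞) y) (v : α → E) {l : List α}
    (hl : l.Nodup) (x : E) :
    iterLineDeriv (l.map v) (Real.exp ∘ y) x =
      Real.exp (y x) * ∑ P : Finpartition l.toFinset,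
        ∏ B ∈ P.parts, iterLineDeriv (B.toList.map v) y x := by
  induction l generalizing x with
  | nil =>
    change Real.exp (y x) = Real.exp (y x) * ∑ P : Finpartition (⊥ : Finset α), _
    rw [Fintype.sum_unique, Finpartition.default_eq_empty]
    simp
  | cons a l ih =>
    obtain ⟨hal, hl⟩ := List.nodup_cons.1 hl
    have ha : a ∉ l.toFinset := by simpa using hal
    have hD (g : E → ℝ) (hg : ContDiff ℝ (⊤ : ℕ∞) g) :
        HasLineDerivAt ℝ g (lineDeriv ℝ g x (v a)) x (v a) :=
      (hg.differentiable (by simp) x).lineDifferentiableAt.hasLineDerivAt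
    have hsum := HasDerivAt.fun_sum (u := (Finset.univ : Finset (Finpartition l.toFinset)))
      fun P _ => HasDerivAt.fun_finsetProd (u := P.parts)
        fun B _ => hD _ (contDiff_iterLineDeriv hy (B.toList.map v))
    have hmain := ((hD y hy).exp.mul hsum).deriv
    rw [List.toFinset_cons, Finpartition.sum_insert ha]
    change lineDeriv ℝ (iterLineDeriv (l.map v) (Real.exp ∘ y)) x (v a) = _
    rw [funext (ih hl)]
    refine hmain.trans ?_
    have hsingle : iterLineDeriv (({a} : Finset α).toList.map v) y x =
        lineDeriv ℝ y x (v a) := by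
      simp [iterLineDeriv]
    have hins (P : Finpartition l.toFinset) (B : Finset α) (hB : B ∈ P.parts) :=
      iterLineDeriv_toList_insert hy v (fun h => ha (P.subset hB h)) x
    rw [Finset.sum_add_distrib, ← Finset.mul_sum, hsingle, mul_add]
    congr 1
    · simp only [zero_smul, add_zero]
      ring
    · simp only [zero_smul, add_zero, smul_eq_mul]
      congr 1
      refine Finset.sum_congr rfl fun P _ => Finset.sum_congr rfl fun B hB => ?_
      rw [hins P B hB]

/-- The exponential formula: the mixed partial derivative
`∂ⁿ (exp ∘ y) / ∂x₁ ⋯ ∂xₙ` equals `exp (y x)` times the sum over all partitions `π` of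
`{1, …, n}` of the product over blocks `B` of `π` of `∂^{|B|} y / ∏_{j ∈ B} ∂x_j`. -/
theorem mixed_partial_exp_comp_eq_sum_finpartitions (n : ℕ) (hn : 0 < n)
    (y : (Fin n → ℝ) → ℝ) (hy : ContDiff ℝ (⊤ : ℕ∞) y) (x : Fin n → ℝ) :
    iterLineDeriv ((List.finRange n).map fun j => Pi.single j (1 : ℝ)) (Real.exp ∘ y) x =
      Real.exp (y x) *
        ∑ π : Finpartition (Finset.univ : Finset (Fin n)),
          ∏ B ∈ π.parts,
            iterLineDeriv (B.toList.map fun j => Pi.single j (1 : ℝ)) y x := by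
  rw [iterLineDeriv_exp_comp hy _ (List.nodup_finRange n), List.toFinset_finRange]
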